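/- Fix N ≥ 1 and a diagonal matrix D = diag(d_1,…,d_N) such that d_i − d_j is a positive integer whenever i < j. Let β be a strictly upper triangular complex N×N matrix, z ∈ ℂ∖{0}, and w, v ∈ ℂ. Then the time-ordered exponentials along straight paths from 0 satisfy the equivariance (scaling) identity Te^{−(1/z)∫_0^{wv} u^Y(β) du/u} = w^Y( Te^{−(1/z)∫_0^{v} u^Y(β) du/u} ), where w^Y acts on a unipotent matrix g = 1 + Σ_{n≥1} g_n (graded components with respect to D) by w^Y(g) = 1 + Σ_{n≥1} w^n g_n; for real w > 0 this equals w^D · Te^{−(1/z)∫_0^{v} u^Y(β) du/u} · w^{−D}. This expresses the 𝔾_m-invariance of the universal singular frame γ(z,v). -/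

import Mathlib

open MeasureTheory Filter Topology
noncomputable section
attribute [local instance] Matrix.normedAddCommGroup Matrix.normedSpace

/-- The graded component `x_n` of a matrix `x`, supported on the positions
`(i,j)` with `d i − d j = n`, for `D = diag d`. -/
def gpart {N : ℕ} (d : Fin N → ℂ) (n : ℕ) (x : Matrix (Fin N) (Fin N) ℂ) :
    Matrix (Fin N) (Fin N) ℂ :=
  Matrix.of fun i j => if d i - d j = (n : ℂ) then x i j else 0

/-- `u^Y(x)/u = Σ_{n≥1} u^{n−1} x_n`, which is entire in `u`. -/
def uYdiv {N : ℕ} (d : Fin N → ℂ) (u : ℂ) (x : Matrix (Fin N) (Fin N) ℂ) :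
    Matrix (Fin N) (Fin N) ℂ :=
  ∑' n : ℕ, u ^ n • gpart d (n + 1) x

/-- A strictly upper triangular matrix. -/
def SUT {N : ℕ} (x : Matrix (Fin N) (Fin N) ℂ) : Prop :=
  ∀ i j : Fin N, ¬ i < j → x i j = 0

/-- The ordered simplex `{a ≤ s 0 ≤ s 1 ≤ ⋯ ≤ s (n-1) ≤ b}`. -/
def orderedSimplex (n : ℕ) (a b : ℝ) : Set (Fin n → ℝ) :=
  {s | (∀ i, s i ∈ Set.Icc a b) ∧ Monotone s}
/-- `Te^{−(1/z)∫_{c₀}^{c₁} u^Y(β) du/u}`: the time-ordered exponential of the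
1-form `−(1/z)·Σ_{n≥1} u^{n−1} β_n du` along the straight path from `c₀` to
`c₁` (pullback `t ↦ −(1/z)(c₁−c₀)·Σ_{n≥1} (c₀+t(c₁−c₀))^{n−1} β_n`). -/
def TexpPath {N : ℕ} (d : Fin N → ℂ) (β : Matrix (Fin N) (Fin N) ℂ)
    (z c₀ c₁ : ℂ) : Matrix (Fin N) (Fin N) ℂ :=
  ∑' n : ℕ, ∫ s in orderedSimplex n 0 1,
    (List.ofFn fun i : Fin n =>
      (-z⁻¹ * (c₁ - c₀)) • uYdiv d (c₀ + (s i : ℂ) * (c₁ - c₀)) β).prod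

/-- `u^Y(x) = Σ_n u^n x_n` (graded components with respect to `D = diag d`);
on a unipotent matrix `g = 1 + Σ_{n≥1} g_n` it acts by
`w^Y(g) = 1 + Σ_{n≥1} w^n g_n`. -/
def uY {N : ℕ} (d : Fin N → ℂ) (u : ℂ) (x : Matrix (Fin N) (Fin N) ℂ) :
    Matrix (Fin N) (Fin N) ℂ :=
  ∑' n : ℕ, u ^ n • gpart d n x

/-- A strictly decreasing natural-number height `a` describes the differences `d i - d j`. -/
lemma exists_strictAnti_height {N : ℕ} (hN : 1 ≤ N) (d : Fin N → ℂ)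
    (hd : ∀ i j : Fin N, i < j → ∃ n : ℕ, 0 < n ∧ d i - d j = (n : ℂ)) :
    ∃ a : Fin N → ℕ, StrictAnti a ∧ ∀ i j, d i - d j = (a i : ℂ) - a j := by
  let l : Fin N := ⟨N - 1, by omega⟩
  have h : ∀ i, ∃ n : ℕ, d i - d l = (n : ℂ) := by
    intro i
    rcases lt_or_eq_of_le (show i ≤ l from Fin.le_def.2 (by simp only [l]; omega)) with hi | rfl
    · obtain ⟨n, -, hn⟩ := hd i l hi
      exact ⟨n, hn⟩
    · exact ⟨0, by simp⟩
  choose a ha using h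
  have hsub : ∀ i j, d i - d j = (a i : ℂ) - a j := fun i j => by
    rw [← ha, ← ha]; ring
  refine ⟨a, fun i j hij => ?_, hsub⟩
  obtain ⟨n, hn, hn'⟩ := hd i j hij
  have : (a i : ℂ) = ((n + a j : ℕ) : ℂ) := by
    push_cast; rw [← hn', hsub]; ring
  have := Nat.cast_injective this
  omega

/-- The entrywise scaling of the upper triangular part by `w ^ (a i - a j)`. -/
def heightScale {N : ℕ} (a : Fin N → ℕ) (w : ℂ) :
    Matrix (Fin N) (Fin N) ℂ →ₗ[ℂ] Matrix (Fin N) (Fin N) ℂ where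
  toFun x := Matrix.of fun i j => if i ≤ j then w ^ (a i - a j) * x i j else 0
  map_add' x y := by
    ext i j
    by_cases h : i ≤ j <;> simp [h, mul_add]
  map_smul' c x := by
    ext i j
    by_cases h : i ≤ j <;> simp [h, mul_left_comm]

lemma heightScale_apply {N : ℕ} (a : Fin N → ℕ) (w : ℂ) (x : Matrix (Fin N) (Fin N) ℂ)
    (i j : Fin N) :
    heightScale a w x i j = if i ≤ j then w ^ (a i - a j) * x i j else 0 := rfl

lemma gpart_apply {N : ℕ} {d : Fin N → ℂ} {a : Fin N → ℕ}
    (had : ∀ i j, d i - d j = (a i : ℂ) - a j) (n : ℕ) (x : Matrix (Fin N) (Fin N) ℂ)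
    (i j : Fin N) : gpart d n x i j = if a i = n + a j then x i j else 0 := by
  have : d i - d j = (n : ℂ) ↔ a i = n + a j := by
    rw [had, sub_eq_iff_eq_add]; norm_cast
  simp [gpart, this]

lemma uY_eq_heightScale {N : ℕ} {d : Fin N → ℂ} {a : Fin N → ℕ} (ha : StrictAnti a)
    (had : ∀ i j, d i - d j = (a i : ℂ) - a j) (w : ℂ) (x : Matrix (Fin N) (Fin N) ℂ) :
    uY d w x = heightScale a w x := by
  refine HasSum.tsum_eq (Pi.hasSum.2 fun i => Pi.hasSum.2 fun j => ?_)
  rw [heightScale_apply]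
  have hij := ha.le_iff_ge (a := j) (b := i)
  convert hasSum_single (a i - a j) ?_ using 1
  · rw [Matrix.smul_apply, gpart_apply had]
    split_ifs with h1 h2 h2 <;> first | omega | simp
  · intro n hn
    rw [Matrix.smul_apply, gpart_apply had, if_neg (by omega), smul_zero]

lemma uYdiv_apply {N : ℕ} {d : Fin N → ℂ} {a : Fin N → ℕ} (ha : StrictAnti a)
    (had : ∀ i j, d i - d j = (a i : ℂ) - a j) (u : ℂ) (x : Matrix (Fin N) (Fin N) ℂ)
    (i j : Fin N) :
    uYdiv d u x i j = if i < j then u ^ (a i - a j - 1) * x i j else 0 := by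
  suffices h : HasSum (fun n : ℕ => u ^ n • gpart d (n + 1) x)
      (Matrix.of fun i j => if i < j then u ^ (a i - a j - 1) * x i j else 0) by
    rw [uYdiv, h.tsum_eq]; rfl
  refine Pi.hasSum.2 fun i => Pi.hasSum.2 fun j => ?_
  have hij := ha.lt_iff_gt (a := j) (b := i)
  rw [Matrix.of_apply]
  convert hasSum_single (a i - a j - 1) ?_ using 1
  · rw [Matrix.smul_apply, gpart_apply had]
    split_ifs with h1 h2 h2 <;> first | omega | simp
  · intro n hn
    rw [Matrix.smul_apply, gpart_apply had, if_neg (by omega), smul_zero]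

lemma heightScale_uYdiv {N : ℕ} {d : Fin N → ℂ} {a : Fin N → ℕ} (ha : StrictAnti a)
    (had : ∀ i j, d i - d j = (a i : ℂ) - a j) (w c u : ℂ) (x : Matrix (Fin N) (Fin N) ℂ) :
    heightScale a w (c • uYdiv d u x) = (w * c) • uYdiv d (w * u) x := by
  ext i j
  rw [heightScale_apply, Matrix.smul_apply, Matrix.smul_apply, uYdiv_apply ha had,
    uYdiv_apply ha had]
  by_cases h : i < j
  · obtain ⟨m, hm⟩ := Nat.exists_eq_add_of_lt (ha h)
    rw [if_pos h.le, if_pos h, if_pos h, show a i - a j = m + 1 by omega]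
    simp only [Nat.add_sub_cancel, smul_eq_mul]
    ring
  · simp [h]

/-- The entries of `x` vanish below the `k`-th superdiagonal. -/
def SupportedAbove {N : ℕ} (k : ℕ) (x : Matrix (Fin N) (Fin N) ℂ) : Prop :=
  ∀ i j : Fin N, x i j ≠ 0 → (i : ℕ) + k ≤ j

lemma SupportedAbove.one {N : ℕ} : SupportedAbove 0 (1 : Matrix (Fin N) (Fin N) ℂ) := by
  intro i j h
  by_contra hij
  exact h (Matrix.one_apply_ne (by rintro rfl; simp at hij))

lemma SupportedAbove.mul {N k l : ℕ} {x y : Matrix (Fin N) (Fin N) ℂ}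
    (hx : SupportedAbove k x) (hy : SupportedAbove l y) : SupportedAbove (l + k) (x * y) := by
  intro i j h
  rw [Matrix.mul_apply] at h
  obtain ⟨m, -, hm⟩ := Finset.exists_ne_zero_of_sum_ne_zero h
  have h1 := hx i m (left_ne_zero_of_mul hm)
  have h2 := hy m j (right_ne_zero_of_mul hm)
  omega

lemma SupportedAbove.eq_zero {N k : ℕ} {x : Matrix (Fin N) (Fin N) ℂ}
    (hx : SupportedAbove k x) (hk : N ≤ k) : x = 0 := by
  ext i j
  by_contra h
  have := hx i j h
  omega

lemma SupportedAbove.list_prod {N : ℕ} (l : List (Matrix (Fin N) (Fin N) ℂ))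
    (hl : ∀ x ∈ l, SupportedAbove 1 x) : SupportedAbove l.length l.prod := by
  induction l with
  | nil => simpa using SupportedAbove.one
  | cons x l ih =>
    rw [List.prod_cons, List.length_cons]
    exact (hl x (by simp)).mul (ih fun y hy => hl y (by simp [hy]))

lemma supportedAbove_smul_uYdiv {N : ℕ} {d : Fin N → ℂ} {a : Fin N → ℕ} (ha : StrictAnti a)
    (had : ∀ i j, d i - d j = (a i : ℂ) - a j) (c u : ℂ) (x : Matrix (Fin N) (Fin N) ℂ) :
    SupportedAbove 1 (c • uYdiv d u x) := by
  intro i j h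
  by_contra hij
  rw [Matrix.smul_apply, uYdiv_apply ha had, if_neg (by omega), smul_zero] at h
  exact h rfl

lemma heightScale_mul {N k l : ℕ} {a : Fin N → ℕ} (ha : StrictAnti a) (w : ℂ)
    {x y : Matrix (Fin N) (Fin N) ℂ} (hx : SupportedAbove k x) (hy : SupportedAbove l y) :
    heightScale a w (x * y) = heightScale a w x * heightScale a w y := by
  ext i j
  simp only [heightScale_apply, Matrix.mul_apply]
  split_ifs with hij
  · rw [Finset.mul_sum]
    refine Finset.sum_congr rfl fun m _ => ?_
    by_cases hxm : x i m = 0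
    · simp [hxm]
    by_cases hym : y m j = 0
    · simp [hym]
    have him : i ≤ m := by have := hx i m hxm; omega
    have hmj : m ≤ j := by have := hy m j hym; omega
    rw [if_pos him, if_pos hmj]
    have h1 := ha.antitone him
    have h2 := ha.antitone hmj
    rw [show a i - a j = (a i - a m) + (a m - a j) by omega, pow_add]
    ring
  · refine (Finset.sum_eq_zero fun m _ => ?_).symm
    by_cases him : i ≤ m
    · rw [if_neg (show ¬ m ≤ j from fun h => hij (him.trans h)), mul_zero]
    · rw [if_neg him, zero_mul]

lemma heightScale_one {N : ℕ} (a : Fin N → ℕ) (w : ℂ) :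
    heightScale a w (1 : Matrix (Fin N) (Fin N) ℂ) = 1 := by
  ext i j
  rw [heightScale_apply]
  by_cases h : i = j
  · subst h; simp
  · simp [Matrix.one_apply_ne h]

lemma heightScale_list_prod {N : ℕ} {a : Fin N → ℕ} (ha : StrictAnti a) (w : ℂ)
    (l : List (Matrix (Fin N) (Fin N) ℂ)) (hl : ∀ x ∈ l, SupportedAbove 1 x) :
    heightScale a w l.prod = (l.map (heightScale a w)).prod := by
  induction l with
  | nil => simpa using heightScale_one a w
  | cons x l ih =>
    have hl' : ∀ y ∈ l, SupportedAbove 1 y := fun y hy => hl y (by simp [hy])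
    rw [List.prod_cons, List.map_cons, List.prod_cons, ← ih hl']
    exact heightScale_mul ha w (hl x (by simp)) (SupportedAbove.list_prod l hl')

lemma isCompact_orderedSimplex (n : ℕ) (a b : ℝ) : IsCompact (orderedSimplex n a b) := by
  have h : orderedSimplex n a b =
      (Set.univ.pi fun _ : Fin n => Set.Icc a b) ∩ {s | Monotone s} := by
    ext s
    simp only [orderedSimplex, Set.mem_inter_iff, Set.mem_univ_pi]
    rfl
  rw [h]
  refine (isCompact_univ_pi fun _ => isCompact_Icc).inter_right ?_
  simp only [Monotone, Set.ofPred_forall]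
  exact isClosed_iInter fun i => isClosed_iInter fun j => isClosed_iInter fun _ =>
    isClosed_le (continuous_apply i) (continuous_apply j)

lemma continuous_uYdiv {N : ℕ} {d : Fin N → ℂ} {a : Fin N → ℕ} (ha : StrictAnti a)
    (had : ∀ i j, d i - d j = (a i : ℂ) - a j) (x : Matrix (Fin N) (Fin N) ℂ) :
    Continuous fun u => uYdiv d u x := by
  refine continuous_pi fun i => continuous_pi fun j => ?_
  simp only [uYdiv_apply ha had]
  split_ifs <;> fun_prop

lemma continuous_prod_ofFn {X M : Type*} [TopologicalSpace X] [TopologicalSpace M] [Monoid M]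
    [ContinuousMul M] {n : ℕ} {f : Fin n → X → M} (hf : ∀ i, Continuous (f i)) :
    Continuous fun s => (List.ofFn fun i => f i s).prod := by
  simp only [List.ofFn_eq_map]
  exact continuous_list_prod _ fun i _ => hf i

lemma TexpPath_mul {N : ℕ} {d : Fin N → ℂ} {a : Fin N → ℕ} (ha : StrictAnti a)
    (had : ∀ i j, d i - d j = (a i : ℂ) - a j) (β : Matrix (Fin N) (Fin N) ℂ) (z w v : ℂ) :
    TexpPath d β z 0 (w * v) = heightScale a w (TexpPath d β z 0 v) := by
  let L : Matrix (Fin N) (Fin N) ℂ →L[ℂ] Matrix (Fin N) (Fin N) ℂ :=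
    LinearMap.toContinuousLinearMap (heightScale a w)
  have hL : ∀ x, heightScale a w x = L x := fun _ => rfl
  have hsupp (n : ℕ) (s : Fin n → ℝ) : ∀ x ∈ List.ofFn fun i : Fin n =>
      (-z⁻¹ * (v - 0)) • uYdiv d (0 + (s i : ℂ) * (v - 0)) β, SupportedAbove 1 x := by
    intro x hx
    obtain ⟨i, rfl⟩ := (List.mem_ofFn' _ _).1 hx
    exact supportedAbove_smul_uYdiv ha had _ _ _
  have hcont (n : ℕ) : Continuous fun s : Fin n → ℝ => (List.ofFn fun i : Fin n =>
      (-z⁻¹ * (v - 0)) • uYdiv d (0 + (s i : ℂ) * (v - 0)) β).prod := by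
    refine continuous_prod_ofFn fun i => ?_
    have h : Continuous fun s : Fin n → ℝ => 0 + (s i : ℂ) * (v - 0) := by fun_prop
    exact ((continuous_uYdiv ha had β).comp h).const_smul (-z⁻¹ * (v - 0))
  unfold TexpPath
  rw [hL, L.map_tsum]
  · refine tsum_congr fun n => ?_
    have hint := (hcont n).continuousOn.integrableOn_compact (μ := volume)
      (isCompact_orderedSimplex n 0 1)
    refine Eq.trans ?_ (L.integral_comp_comm hint)
    congr 1
    ext1 s
    refine Eq.trans ?_ (heightScale_list_prod ha w _ (hsupp n s)).symm
    rw [List.map_ofFn]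
    congr 2
    ext1 i
    rw [Function.comp_apply, heightScale_uYdiv ha had,
      show w * (-z⁻¹ * (v - 0)) = -z⁻¹ * (w * v - 0) by ring,
      show w * (0 + (s i : ℂ) * (v - 0)) = 0 + (s i : ℂ) * (w * v - 0) by ring]
  · refine summable_of_ne_finset_zero (s := Finset.range N) fun n hn => ?_
    refine (integral_congr_ae (ae_of_all _ fun s => ?_)).trans (integral_zero _ _)
    refine (SupportedAbove.list_prod _ (hsupp n s)).eq_zero ?_
    simpa using hn

/-- Equivariance (scaling) identity for the universal singular frame:
`Te^{−(1/z)∫_0^{wv} u^Y(β) du/u} = w^Y(Te^{−(1/z)∫_0^{v} u^Y(β) du/u})`, and for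
real `w > 0` this equals `w^D · Te^{−(1/z)∫_0^{v} u^Y(β) du/u} · w^{−D}`. -/
theorem stmt14 {N : ℕ} (hN : 1 ≤ N) (d : Fin N → ℂ)
    (hd : ∀ i j : Fin N, i < j → ∃ n : ℕ, 0 < n ∧ d i - d j = (n : ℂ))
    (β : Matrix (Fin N) (Fin N) ℂ) (hβ : SUT β) (z : ℂ) (hz : z ≠ 0) :
    (∀ w v : ℂ, TexpPath d β z 0 (w * v) = uY d w (TexpPath d β z 0 v)) ∧
    (∀ w : ℝ, 0 < w → ∀ v : ℂ,
      TexpPath d β z 0 ((w : ℂ) * v) =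
        Matrix.diagonal (fun i => (w : ℂ) ^ (d i)) * TexpPath d β z 0 v *
          Matrix.diagonal (fun i => (w : ℂ) ^ (-(d i)))) := by
  obtain ⟨a, ha, had⟩ := exists_strictAnti_height hN d hd
  refine ⟨fun w v => ?_, fun w hw v => ?_⟩
  · rw [uY_eq_heightScale ha had, TexpPath_mul ha had]
  · have hupper : TexpPath d β z 0 v = heightScale a 1 (TexpPath d β z 0 v) := by
      rw [← TexpPath_mul ha had, one_mul]
    rw [TexpPath_mul ha had]
    ext i j
    rw [Matrix.mul_diagonal, Matrix.diagonal_mul, heightScale_apply]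
    split_ifs with hij
    · have hw' : (w : ℂ) ≠ 0 := by exact_mod_cast hw.ne'
      have hpow : (w : ℂ) ^ (a i - a j) = (w : ℂ) ^ d i * (w : ℂ) ^ (-d j) := by
        rw [← Complex.cpow_add _ _ hw', ← sub_eq_add_neg, had,
          ← Nat.cast_sub (ha.antitone hij), Complex.cpow_natCast]
      rw [hpow]
      ring
    · rw [hupper, heightScale_apply, if_neg hij]
      simp
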